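/- Let p = 2 and define J₂(w) := −(1/2) log(1 − w²) for w ∈ (−1,1) and J₂(w) := +∞ otherwise. Then for every θ ∈ 𝕊 (not just almost every θ), the sequence (W_θ^{(n,2)})_{n∈ℕ} satisfies a large deviation principle with speed n and good rate function J₂. Moreover 𝕀ᵃ₂ = 𝕀^q_{2,μ₂} = J₂ as functions on ℝ. -/

import Mathlib

open MeasureTheory Filter Topology Set ProbabilityTheory
open scoped ENNReal NNReal

noncomputable section

namespace LDP

/-- The nonnegative part of an extended real, as an extended nonnegative real. -/
def erealToENNReal (x : EReal) : ℝ≥0∞ := if x = ⊤ then ⊤ else ENNReal.ofReal x.toReal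

/-- Extended (possibly infinite) integral of an `EReal`-valued function:
positive part minus negative part. -/
def eIntegral (ν : Measure ℝ) (f : ℝ → EReal) : EReal :=
  ((∫⁻ u, erealToENNReal (f u) ∂ν : ℝ≥0∞) : EReal)
    - ((∫⁻ u, erealToENNReal (-f u) ∂ν : ℝ≥0∞) : EReal)

/-- `q`-th absolute moment of a measure on `ℝ`. -/
def mom (q : ℝ) (ν : Measure ℝ) : ℝ≥0∞ := ∫⁻ x, ENNReal.ofReal (|x| ^ q) ∂ν

open Classical in
/-- Relative entropy `H(ν|μ)`. -/
def relEnt (ν μ : Measure ℝ) : EReal :=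
  if ν ≪ μ then eIntegral ν (fun x => ENNReal.log (ν.rnDeriv μ x)) else ⊤

/-- The generalized normal distribution `μ_p` on `ℝ`. -/
def muP (p : ℝ) : Measure ℝ :=
  volume.withDensity fun y =>
    ENNReal.ofReal ((2 * p ^ (1/p) * Real.Gamma (1 + 1/p))⁻¹ * Real.exp (-(|y| ^ p) / p))

/-- The uniform probability measure `μ_∞` on `[-1,1]`. -/
def muInf : Measure ℝ := (volume (Icc (-1:ℝ) 1))⁻¹ • volume.restrict (Icc (-1:ℝ) 1)

/-- Extended-real-valued log moment generating function of a measure on `ℝ`. -/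
def logM (γ : Measure ℝ) (t : ℝ) : EReal :=
  ENNReal.log (∫⁻ y, ENNReal.ofReal (Real.exp (t * y)) ∂γ)

/-- The class `𝒯_q` of measures whose log mgf is dominated by `C|t|^{q/(q-1)} + C`. -/
def memT (q : ℝ) (γ : Measure ℝ) : Prop :=
  ∃ C : ℝ, ∀ t : ℝ, logM γ t ≤ ((C * |t| ^ (q/(q-1)) + C : ℝ) : EReal)

/-- Legendre transform of a function of one real variable. -/
def legendre1 (Λ : ℝ → EReal) (τ : ℝ) : EReal := ⨆ t : ℝ, ((t * τ : ℝ) : EReal) - Λ t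

/-- Legendre transform of a function of two real variables. -/
def legendre2 (Λ : ℝ × ℝ → EReal) (τ : ℝ × ℝ) : EReal :=
  ⨆ t : ℝ × ℝ, ((t.1 * τ.1 + t.2 * τ.2 : ℝ) : EReal) - Λ t

/-- Legendre transform of a function of three real variables. -/
def legendre3 (Λ : ℝ × ℝ × ℝ → EReal) (τ : ℝ × ℝ × ℝ) : EReal :=
  ⨆ t : ℝ × ℝ × ℝ, ((t.1 * τ.1 + t.2.1 * τ.2.1 + t.2.2 * τ.2.2 : ℝ) : EReal) - Λ t

/-- `Φ_p(t₀,t₁,t₂) = log ∫∫ exp(t₀ z² + t₁ z y + t₂ |y|^p) μ₂(dz) μ_p(dy)`. -/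
def Phi (p : ℝ) (t : ℝ × ℝ × ℝ) : EReal :=
  ENNReal.log (∫⁻ y, (∫⁻ z,
    ENNReal.ofReal (Real.exp (t.1 * z^2 + t.2.1 * z * y + t.2.2 * |y| ^ p)) ∂(muP 2)) ∂(muP p))

/-- The annealed rate function `𝕀ᵃ_p` for `p ∈ [2,∞)`. -/
def Ia (p : ℝ) (w : ℝ) : EReal :=
  ⨅ τ ∈ {τ : ℝ × ℝ × ℝ | 0 < τ.1 ∧ 0 < τ.2.2 ∧
      τ.1 ^ (-(1:ℝ)/2) * τ.2.1 * τ.2.2 ^ (-(1:ℝ)/p) = w},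
    legendre3 (Phi p) τ

/-- `Λ_p(t₁,t₂) = log ∫ exp(t₁ y + t₂|y|^p) μ_p(dy)`. -/
def LamP (p : ℝ) (t : ℝ × ℝ) : EReal :=
  ENNReal.log (∫⁻ y, ENNReal.ofReal (Real.exp (t.1 * y + t.2 * |y| ^ p)) ∂(muP p))

/-- `Ψ_{p,ν}(t₁,t₂) = ∫ Λ_p(t₁ u, t₂) ν(du)`. -/
def Psi (p : ℝ) (ν : Measure ℝ) (t : ℝ × ℝ) : EReal :=
  eIntegral ν (fun u => LamP p (t.1 * u, t.2))

/-- The quenched rate function `𝕀^q_{p,ν}`. -/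
def Iq (p : ℝ) (ν : Measure ℝ) (w : ℝ) : EReal :=
  ⨅ τ ∈ {τ : ℝ × ℝ | 0 < τ.2 ∧ τ.1 * τ.2 ^ (-(1:ℝ)/p) = w}, legendre2 (Psi p ν) τ

/-- The Cramér-type rate function `𝕀^{cr}_p`. -/
def Icr (p : ℝ) (w : ℝ) : EReal :=
  ⨅ τ ∈ {τ : ℝ × ℝ | 0 < τ.2 ∧ τ.1 * τ.2 ^ (-(1:ℝ)/p) = w}, legendre2 (LamP p) τ

/-- `Φ_γ(t₀,t₁) = log ∫∫ exp(t₀ z² + t₁ z x) μ₂(dz) γ(dx)`. -/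
def Phig (γ : Measure ℝ) (t : ℝ × ℝ) : EReal :=
  ENNReal.log (∫⁻ x, (∫⁻ z,
    ENNReal.ofReal (Real.exp (t.1 * z^2 + t.2 * z * x)) ∂(muP 2)) ∂γ)

/-- The annealed rate function `𝕀ᵃ_γ` for a product measure `γ^{⊗n}`. -/
def Iag (γ : Measure ℝ) (w : ℝ) : EReal :=
  ⨅ τ ∈ {τ : ℝ × ℝ | 0 < τ.1 ∧ τ.1 ^ (-(1:ℝ)/2) * τ.2 = w}, legendre2 (Phig γ) τ

/-- `Ψ_{γ,ν}(t) = ∫ log M_γ(t u) ν(du)`. -/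
def Psig (γ ν : Measure ℝ) (t : ℝ) : EReal := eIntegral ν (fun u => logM γ (t * u))

/-- The quenched rate function `𝕀^q_{γ,ν}` for a product measure. -/
def Iqg (γ ν : Measure ℝ) : ℝ → EReal := legendre1 (Psig γ ν)

/-- `Ψ_{∞,ν}`. -/
def PsiInf (ν : Measure ℝ) : ℝ → EReal := Psig muInf ν

/-- `𝕀^q_{∞,ν}`. -/
def IqInf (ν : Measure ℝ) : ℝ → EReal := legendre1 (PsiInf ν)

/-- `𝕀ᵃ_∞`. -/
def IaInf : ℝ → EReal := Iag muInf

/-- Euclidean inner product on `ℝⁿ`. -/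
def dotp {n : ℕ} (x y : Fin n → ℝ) : ℝ := ∑ i, x i * y i

/-- The unit ℓ^p ball of `ℝⁿ`. -/
def lpBall (n : ℕ) (p : ℝ) : Set (Fin n → ℝ) := {x | ∑ i, |x i| ^ p ≤ 1}

/-- The uniform probability measure on the unit ℓ^p ball. -/
def uniformLpBall (n : ℕ) (p : ℝ) : Measure (Fin n → ℝ) :=
  (volume (lpBall n p))⁻¹ • volume.restrict (lpBall n p)

/-- The unit Euclidean sphere in `ℝⁿ`. -/
def unitSphereSet (n : ℕ) : Set (Fin n → ℝ) := {x | ∑ i, (x i)^2 = 1}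

/-- `μ` is the (unique) rotation-invariant probability measure on the unit sphere `S^{n-1}`. -/
def IsUniformSphere {n : ℕ} (μ : Measure (Fin n → ℝ)) : Prop :=
  IsProbabilityMeasure μ ∧ μ (unitSphereSet n) = 1 ∧
    ∀ O : Matrix.orthogonalGroup (Fin n) ℝ,
      Measure.map (fun x => (O : Matrix (Fin n) (Fin n) ℝ).mulVec x) μ = μ

/-- A large deviation principle with speed `s` and rate function `I`. -/
def IsLDP {Ω : Type*} [MeasurableSpace Ω] (P : Measure Ω)
    (ξ : ℕ → Ω → ℝ) (s : ℕ → ℝ) (I : ℝ → EReal) : Prop :=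
  LowerSemicontinuous I ∧
    ∀ Γ : Set ℝ, MeasurableSet Γ →
      (-(⨅ x ∈ interior Γ, I x) ≤
        atTop.liminf fun n =>
          (((s n)⁻¹ : ℝ) : EReal) * ENNReal.log (P {ω | ξ n ω ∈ interior Γ})) ∧
      ((atTop.limsup fun n =>
          (((s n)⁻¹ : ℝ) : EReal) * ENNReal.log (P {ω | ξ n ω ∈ closure Γ})) ≤
        -(⨅ x ∈ closure Γ, I x))

/-- Goodness of a rate function: compact sublevel sets. -/
def HasCompactSublevels (I : ℝ → EReal) : Prop := ∀ c : ℝ, IsCompact {x | I x ≤ (c : EReal)}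

/-- Quasiconvexity: convex sublevel sets. -/
def QuasiconvexRate (I : ℝ → EReal) : Prop := ∀ c : EReal, Convex ℝ {x | I x ≤ c}

/-- Symmetry: `I(-w) = I(w)`. -/
def SymmetricRate (I : ℝ → EReal) : Prop := ∀ w : ℝ, I (-w) = I w

/-- Convexity of an extended-real-valued rate function. -/
def ConvexRate (I : ℝ → EReal) : Prop :=
  ∀ x y a b : ℝ, 0 ≤ a → 0 ≤ b → a + b = 1 →
    I (a * x + b * y) ≤ (a : EReal) * I x + (b : EReal) * I y

/-- Convexity on a set, for extended-real-valued functions. -/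
def ConvexOnE (s : Set ℝ) (g : ℝ → EReal) : Prop :=
  ∀ x ∈ s, ∀ y ∈ s, ∀ a b : ℝ, 0 ≤ a → 0 ≤ b → a + b = 1 →
    g (a * x + b * y) ≤ (a : EReal) * g x + (b : EReal) * g y

/-- Concavity on a set, for extended-real-valued functions. -/
def ConcaveOnE (s : Set ℝ) (g : ℝ → EReal) : Prop :=
  ∀ x ∈ s, ∀ y ∈ s, ∀ a b : ℝ, 0 ≤ a → 0 ≤ b → a + b = 1 →
    (a : EReal) * g x + (b : EReal) * g y ≤ g (a * x + b * y)

/-- Strict convexity, for extended-real-valued functions. -/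
def StrictConvexE (g : ℝ → EReal) : Prop :=
  ∀ x y : ℝ, x ≠ y → ∀ a b : ℝ, 0 < a → 0 < b → a + b = 1 →
    g (a * x + b * y) < (a : EReal) * g x + (b : EReal) * g y

/-- The property of agreeing with a real affine function on a set. -/
def AffineOnE (s : Set ℝ) (g : ℝ → EReal) : Prop :=
  ∃ m q : ℝ, ∀ t ∈ s, g t = ((m * t + q : ℝ) : EReal)

/-- Empirical measure `L_{n,θ} = (1/n) Σ δ_{√n θ_i}`. -/
def empMeas (n : ℕ) (θn : Fin n → ℝ) : Measure ℝ :=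
  ((n : ℝ≥0∞))⁻¹ • ∑ i : Fin n, Measure.dirac (Real.sqrt n * θn i)

end LDP

open LDP

open Classical in
/-- The rate function `J₂` for `p = 2`. -/
noncomputable def J2 : ℝ → EReal := fun w =>
  if -1 < w ∧ w < 1 then (((-(1:ℝ)/2) * Real.log (1 - w^2) : ℝ) : EReal) else ⊤

lemma muP_two : muP 2 = gaussianReal 0 1 := by
  rw [gaussianReal_of_var_ne_zero 0 one_ne_zero, muP]
  congr 1
  ext y
  rw [gaussianPDF, gaussianPDFReal]
  congr 2
  · have h : (1 : ℝ) + 1 / 2 = 1 / 2 + 1 := by ring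
    rw [h, Real.Gamma_add_one (by norm_num), Real.Gamma_one_half_eq, ← Real.sqrt_eq_rpow]
    simp only [NNReal.coe_one, mul_one]
    rw [Real.sqrt_mul (by norm_num)]
    ring
  · simp

/-- Exponential-quadratic moments of the standard Gaussian, finite case. -/
lemma lintegral_exp_quadratic_gaussian {s : ℝ} (hs : s < 1 / 2) (β : ℝ) :
    ∫⁻ x, ENNReal.ofReal (Real.exp (s * x ^ 2 + β * x)) ∂(gaussianReal 0 1)
      = ENNReal.ofReal (Real.exp (-(1 / 2) * Real.log (1 - 2 * s) + β ^ 2 / (2 * (1 - 2 * s)))) := by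
  have ha : 0 < 1 - 2 * s := by linarith
  set a := 1 - 2 * s with ha_def
  obtain ⟨v, hv⟩ : ∃ v : ℝ≥0, (v : ℝ) = a⁻¹ := ⟨⟨a⁻¹, by positivity⟩, rfl⟩
  have hv0 : v ≠ 0 := by
    intro h
    rw [h] at hv
    have : 0 < a⁻¹ := by positivity
    simp at hv
    linarith
  rw [gaussianReal_of_var_ne_zero 0 one_ne_zero,
    lintegral_withDensity_eq_lintegral_mul _ (measurable_gaussianPDF 0 1) (by fun_prop)]
  have key : ∀ x : ℝ, gaussianPDFReal 0 1 x * Real.exp (s * x ^ 2 + β * x)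
      = Real.exp (-(1 / 2) * Real.log a + β ^ 2 / (2 * a)) * gaussianPDFReal (β * a⁻¹) v x := by
    intro x
    have hexp : Real.exp (-(1 / 2) * Real.log a) = (√a)⁻¹ := by
      rw [Real.sqrt_eq_rpow, Real.rpow_def_of_pos ha, ← Real.exp_neg]
      congr 1
      ring
    have hsq : (√(2 * Real.pi * a⁻¹))⁻¹ = (√(2 * Real.pi))⁻¹ * √a := by
      rw [Real.sqrt_mul (by positivity), Real.sqrt_inv, mul_inv, inv_inv]
    have hsa : (√a)⁻¹ * √a = 1 := inv_mul_cancel₀ (by positivity)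
    simp only [gaussianPDFReal, hv, hsq, NNReal.coe_one, mul_one]
    rw [Real.exp_add (-(1 / 2) * Real.log a), hexp]
    have h1 : Real.exp (-(x - 0) ^ 2 / 2) * Real.exp (s * x ^ 2 + β * x)
        = Real.exp (β ^ 2 / (2 * a)) * Real.exp (-(x - β * a⁻¹) ^ 2 / (2 * a⁻¹)) := by
      rw [← Real.exp_add, ← Real.exp_add]
      congr 1
      have : s = (1 - a) / 2 := by rw [ha_def]; ring
      rw [this]
      field_simp
      ring
    linear_combination (√(2 * Real.pi))⁻¹ * h1 - (√(2 * Real.pi))⁻¹ *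
      Real.exp (β ^ 2 / (2 * a)) * Real.exp (-(x - β * a⁻¹) ^ 2 / (2 * a⁻¹)) * hsa
  have : ∀ x : ℝ, (gaussianPDF 0 1 * fun x => ENNReal.ofReal (Real.exp (s * x ^ 2 + β * x))) x
      = ENNReal.ofReal (Real.exp (-(1 / 2) * Real.log a + β ^ 2 / (2 * a)))
        * ENNReal.ofReal (gaussianPDFReal (β * a⁻¹) v x) := by
    intro x
    rw [Pi.mul_apply, gaussianPDF, ← ENNReal.ofReal_mul (gaussianPDFReal_nonneg _ _ _), key,
      ENNReal.ofReal_mul (by positivity)]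
  simp_rw [this]
  rw [lintegral_const_mul _ (by fun_prop), lintegral_gaussianPDFReal_eq_one _ hv0, mul_one]

/-- Exponential-quadratic moments of the standard Gaussian, divergent case. -/
lemma lintegral_exp_quadratic_gaussian_eq_top {s : ℝ} (hs : 1 / 2 ≤ s) (β : ℝ) :
    ∫⁻ x, ENNReal.ofReal (Real.exp (s * x ^ 2 + β * x)) ∂(gaussianReal 0 1) = ⊤ := by
  rw [gaussianReal_of_var_ne_zero 0 one_ne_zero,
    lintegral_withDensity_eq_lintegral_mul _ (measurable_gaussianPDF 0 1) (by fun_prop)]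
  have hvol : volume {x : ℝ | 0 ≤ β * x} = ⊤ := by
    rcases le_total 0 β with h | h
    · exact measure_mono_top (fun x (hx : 0 ≤ x) => mul_nonneg h hx) (Real.volume_Ici (a := 0))
    · exact measure_mono_top (fun x (hx : x ≤ 0) => mul_nonneg_of_nonpos_of_nonpos h hx)
        (Real.volume_Iic (a := 0))
  have hms : MeasurableSet {x : ℝ | 0 ≤ β * x} := measurableSet_le (by fun_prop) (by fun_prop)
  rw [eq_top_iff]
  calc (⊤ : ℝ≥0∞) = ∫⁻ _ in {x : ℝ | 0 ≤ β * x}, ENNReal.ofReal (√(2 * Real.pi))⁻¹ := by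
        rw [setLIntegral_const, hvol, ENNReal.mul_top]
        simp [Real.pi_pos]
    _ ≤ ∫⁻ x in {x : ℝ | 0 ≤ β * x},
          (gaussianPDF 0 1 * fun x => ENNReal.ofReal (Real.exp (s * x ^ 2 + β * x))) x := by
        refine setLIntegral_mono' hms fun x hx => ?_
        rw [Pi.mul_apply, gaussianPDF, ← ENNReal.ofReal_mul (gaussianPDFReal_nonneg _ _ _)]
        refine ENNReal.ofReal_le_ofReal ?_
        simp only [gaussianPDFReal, NNReal.coe_one, mul_one, mul_assoc, ← Real.exp_add]
        refine le_mul_of_one_le_right (by positivity) (Real.one_le_exp ?_)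
        have hx' : 0 ≤ β * x := hx
        nlinarith [sq_nonneg x]
    _ ≤ _ := setLIntegral_le_lintegral _ _

lemma log_ofReal_exp (x : ℝ) : ENNReal.log (ENNReal.ofReal (Real.exp x)) = (x : EReal) := by
  rw [ENNReal.log_ofReal_of_pos (Real.exp_pos x), Real.log_exp]

lemma LamP_two_of_lt {t : ℝ × ℝ} (ht : t.2 < 1 / 2) :
    LamP 2 t = ((-(1 / 2) * Real.log (1 - 2 * t.2) + t.1 ^ 2 / (2 * (1 - 2 * t.2)) : ℝ) : EReal) := by
  have h := lintegral_exp_quadratic_gaussian ht t.1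
  rw [LamP, muP_two, ← log_ofReal_exp, ← h]
  simp [add_comm]

lemma LamP_two_of_ge {t : ℝ × ℝ} (ht : 1 / 2 ≤ t.2) : LamP 2 t = ⊤ := by
  have h := lintegral_exp_quadratic_gaussian_eq_top ht t.1
  rw [LamP, muP_two, ← ENNReal.log_top, ← h]
  simp [add_comm]

lemma eIntegral_coe {ν : Measure ℝ} {f : ℝ → ℝ} (hf : Integrable f ν) :
    eIntegral ν (fun u => (f u : EReal)) = ((∫ u, f u ∂ν : ℝ) : EReal) := by
  have h1 : ∀ x : ℝ, erealToENNReal (x : EReal) = ENNReal.ofReal x := by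
    intro x; simp [erealToENNReal]
  have h2 : ∀ x : ℝ, erealToENNReal (-(x : EReal)) = ENNReal.ofReal (-x) := by
    intro x; rw [← EReal.coe_neg, h1]
  simp only [eIntegral, h1, h2]
  rw [integral_eq_lintegral_pos_part_sub_lintegral_neg_part hf, EReal.coe_sub,
    EReal.coe_ennreal_toReal hf.lintegral_lt_top.ne,
    EReal.coe_ennreal_toReal (x := ∫⁻ u, ENNReal.ofReal (-f u) ∂ν) hf.neg.lintegral_lt_top.ne]

lemma Psi_two_of_lt {t : ℝ × ℝ} (ht : t.2 < 1 / 2) :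
    Psi 2 (muP 2) t
      = ((-(1 / 2) * Real.log (1 - 2 * t.2) + t.1 ^ 2 / (2 * (1 - 2 * t.2)) : ℝ) : EReal) := by
  have hsq : Integrable (fun u : ℝ => u ^ 2) (gaussianReal 0 1) :=
    (memLp_id_gaussianReal (μ := 0) (v := 1) 2).integrable_sq
  have hmom : ∫ u, u ^ 2 ∂(gaussianReal 0 1) = 1 := by
    have h := variance_id_gaussianReal (μ := 0) (v := 1)
    rw [variance_of_integral_eq_zero aemeasurable_id (by simp)] at h
    simpa using h
  have hL : ∀ u : ℝ, LamP 2 (t.1 * u, t.2) = ((-(1 / 2) * Real.log (1 - 2 * t.2)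
      + t.1 ^ 2 / (2 * (1 - 2 * t.2)) * u ^ 2 : ℝ) : EReal) := by
    intro u
    rw [LamP_two_of_lt (t := (t.1 * u, t.2)) ht]
    congr 2
    simp only
    ring
  simp only [Psi, hL, muP_two]
  have hint : Integrable (fun u : ℝ => -(1 / 2) * Real.log (1 - 2 * t.2)
      + t.1 ^ 2 / (2 * (1 - 2 * t.2)) * u ^ 2) (gaussianReal 0 1) :=
    (integrable_const _).add (hsq.const_mul _)
  rw [eIntegral_coe hint, integral_add (integrable_const _) (hsq.const_mul _), integral_const_mul _ (fun u : ℝ => u ^ 2),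
    hmom]
  simp

lemma Psi_two_of_ge {t : ℝ × ℝ} (ht : 1 / 2 ≤ t.2) : Psi 2 (muP 2) t = ⊤ := by
  have hL : ∀ u : ℝ, LamP 2 (t.1 * u, t.2) = ⊤ := fun u => LamP_two_of_ge ht
  simp [Psi, hL, muP_two, eIntegral, erealToENNReal]

lemma Phi_two_inner (t : ℝ × ℝ × ℝ) (y : ℝ) :
    ∫⁻ z, ENNReal.ofReal (Real.exp (t.1 * z ^ 2 + t.2.1 * z * y + t.2.2 * |y| ^ (2 : ℝ))) ∂(muP 2)
      = ENNReal.ofReal (Real.exp (t.2.2 * y ^ 2)) *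
        ∫⁻ z, ENNReal.ofReal (Real.exp (t.1 * z ^ 2 + (t.2.1 * y) * z)) ∂(gaussianReal 0 1) := by
  rw [muP_two, ← lintegral_const_mul _ (by fun_prop)]
  refine lintegral_congr fun z => ?_
  rw [← ENNReal.ofReal_mul (by positivity), ← Real.exp_add]
  congr 2
  simp
  ring

lemma Phi_two_of_ge {t : ℝ × ℝ × ℝ} (ht : 1 / 2 ≤ t.1) : Phi 2 t = ⊤ := by
  have h : ∀ y : ℝ, ENNReal.ofReal (Real.exp (t.2.2 * y ^ 2)) * ⊤ = ⊤ := fun y =>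
    ENNReal.mul_top (by simp [Real.exp_pos])
  simp only [Phi, Phi_two_inner, lintegral_exp_quadratic_gaussian_eq_top ht, h]
  simp [muP_two]

lemma Phi_two_eq_log_mul {t : ℝ × ℝ × ℝ} (ht : t.1 < 1 / 2) :
    Phi 2 t = ENNReal.log (ENNReal.ofReal (Real.exp (-(1 / 2) * Real.log (1 - 2 * t.1))) *
      ∫⁻ y, ENNReal.ofReal (Real.exp ((t.2.2 + t.2.1 ^ 2 / (2 * (1 - 2 * t.1))) * y ^ 2 + 0 * y))
        ∂(gaussianReal 0 1)) := by
  simp only [Phi, Phi_two_inner, lintegral_exp_quadratic_gaussian ht]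
  rw [← lintegral_const_mul _ (by fun_prop), muP_two]
  congr 1
  refine lintegral_congr fun y => ?_
  rw [← ENNReal.ofReal_mul (by positivity), ← Real.exp_add,
    ← ENNReal.ofReal_mul (by positivity), ← Real.exp_add]
  congr 2
  ring

lemma Phi_two_of_schur_nonpos {t : ℝ × ℝ × ℝ} (ht : t.1 < 1 / 2)
    (h : 1 / 2 ≤ t.2.2 + t.2.1 ^ 2 / (2 * (1 - 2 * t.1))) : Phi 2 t = ⊤ := by
  rw [Phi_two_eq_log_mul ht, lintegral_exp_quadratic_gaussian_eq_top h,
    ENNReal.mul_top (by simp [Real.exp_pos]), ENNReal.log_top]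

lemma Phi_two_of_det_pos {t : ℝ × ℝ × ℝ} (ht : t.1 < 1 / 2)
    (h : 0 < (1 - 2 * t.1) * (1 - 2 * t.2.2) - t.2.1 ^ 2) :
    Phi 2 t = ((-(1 / 2) * Real.log ((1 - 2 * t.1) * (1 - 2 * t.2.2) - t.2.1 ^ 2) : ℝ) : EReal) := by
  have ha : 0 < 1 - 2 * t.1 := by linarith
  have heq : 1 - 2 * (t.2.2 + t.2.1 ^ 2 / (2 * (1 - 2 * t.1)))
      = ((1 - 2 * t.1) * (1 - 2 * t.2.2) - t.2.1 ^ 2) / (1 - 2 * t.1) := by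
    field_simp
    ring
  have hpos := div_pos h ha
  rw [Phi_two_eq_log_mul ht, lintegral_exp_quadratic_gaussian (by linarith), heq,
    ← ENNReal.ofReal_mul (by positivity), ← Real.exp_add, log_ofReal_exp,
    Real.log_div h.ne' ha.ne']
  congr 1
  ring

lemma J2_of_sq_lt {w : ℝ} (hw : w ^ 2 < 1) :
    J2 w = ((-(1 / 2) * Real.log (1 - w ^ 2) : ℝ) : EReal) := by
  rw [J2, if_pos (sq_lt_one_iff_abs_lt_one w |>.1 hw |> abs_lt.1)]
  norm_num

lemma J2_of_one_le_sq {w : ℝ} (hw : 1 ≤ w ^ 2) : J2 w = ⊤ := by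
  rw [J2, if_neg]
  rintro ⟨h1, h2⟩
  nlinarith

lemma J2_le_coe_iff (w c : ℝ) : J2 w ≤ (c : EReal) ↔ w ^ 2 ≤ 1 - Real.exp (-2 * c) := by
  rcases lt_or_ge (w ^ 2) 1 with hw | hw
  · rw [J2_of_sq_lt hw, EReal.coe_le_coe_iff, ← sub_nonneg (b := w ^ 2),
      show 1 - Real.exp (-2 * c) - w ^ 2 = (1 - w ^ 2) - Real.exp (-2 * c) by ring, sub_nonneg,
      ← Real.le_log_iff_exp_le (by linarith)]
    constructor <;> intro h <;> linarith
  · simp only [J2_of_one_le_sq hw, top_le_iff, EReal.coe_ne_top, false_iff, not_le]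
    have := Real.exp_pos (-2 * c)
    linarith

lemma hasCompactSublevels_J2 : HasCompactSublevels J2 := by
  intro c
  simp only [J2_le_coe_iff]
  refine Metric.isCompact_of_isClosed_isBounded (isClosed_le (by fun_prop) (by fun_prop))
    ((Metric.isBounded_Icc (-1 : ℝ) 1).subset fun w hw => ?_)
  have := Real.exp_pos (-2 * c)
  have hw : w ^ 2 ≤ 1 - Real.exp (-2 * c) := hw
  constructor <;> nlinarith

lemma lowerSemicontinuous_J2 : LowerSemicontinuous J2 := by
  rw [lowerSemicontinuous_iff_isClosed_preimage]
  intro y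
  induction y with
  | bot =>
    convert isClosed_empty (X := ℝ)
    ext w
    rcases lt_or_ge (w ^ 2) 1 with hw | hw
    · simpa only [mem_preimage, mem_Iic, le_bot_iff, mem_empty_iff_false, iff_false,
        J2_of_sq_lt hw] using EReal.coe_ne_bot _
    · simp [J2_of_one_le_sq hw]
  | top => simp
  | coe c => exact (hasCompactSublevels_J2 c).isClosed

lemma rpow_neg_one_div_two {x : ℝ} (hx : 0 ≤ x) : x ^ (-(1 : ℝ) / 2) = (√x)⁻¹ := by
  rw [neg_div, Real.rpow_neg hx, Real.sqrt_eq_rpow]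

lemma le_legendre2_Psi (τ : ℝ × ℝ) (t c : ℝ) (hc : 0 < c) :
    ((t * τ.1 + (1 - c) / 2 * τ.2 + 1 / 2 * Real.log c - t ^ 2 / (2 * c) : ℝ) : EReal)
      ≤ legendre2 (Psi 2 (muP 2)) τ := by
  refine le_trans (le_of_eq ?_) (le_iSup _ ((t, (1 - c) / 2) : ℝ × ℝ))
  rw [Psi_two_of_lt (t := (t, (1 - c) / 2)) (by simp only; linarith), ← EReal.coe_sub]
  simp only [show 1 - 2 * ((1 - c) / 2) = c by ring]
  congr 1
  ring

lemma legendre2_Psi_le (τ : ℝ × ℝ) (M : ℝ)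
    (h : ∀ t c : ℝ, 0 < c →
      t * τ.1 + (1 - c) / 2 * τ.2 + 1 / 2 * Real.log c - t ^ 2 / (2 * c) ≤ M) :
    legendre2 (Psi 2 (muP 2)) τ ≤ M := by
  refine iSup_le fun t => ?_
  rcases lt_or_ge t.2 (1 / 2) with ht | ht
  · rw [Psi_two_of_lt ht, ← EReal.coe_sub, EReal.coe_le_coe_iff]
    refine le_trans (le_of_eq ?_) (h t.1 (1 - 2 * t.2) (by linarith))
    ring
  · rw [Psi_two_of_ge ht]
    simp

lemma Iq_two_eq (w : ℝ) : Iq 2 (muP 2) w = J2 w := by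
  apply le_antisymm
  · rcases lt_or_ge (w ^ 2) 1 with hw | hw
    · rw [J2_of_sq_lt hw]
      refine (iInf₂_le (w, 1) (by simp)).trans (legendre2_Psi_le _ _ fun t c hc => ?_)
      have hD : 0 < 1 - w ^ 2 := by linarith
      have hlog := Real.log_le_sub_one_of_pos (mul_pos hc hD)
      rw [Real.log_mul hc.ne' hD.ne'] at hlog
      have hsq : t * w - t ^ 2 / (2 * c) = c * w ^ 2 / 2 - (t - c * w) ^ 2 / (2 * c) := by
        field_simp
        ring
      have : 0 ≤ (t - c * w) ^ 2 / (2 * c) := by positivity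
      simp only
      linarith
    · rw [J2_of_one_le_sq hw]
      exact le_top
  · refine le_iInf₂ fun τ hτ => ?_
    obtain ⟨h2, h⟩ := hτ
    rw [rpow_neg_one_div_two h2.le] at h
    obtain ⟨q, hq, hτ2⟩ : ∃ q : ℝ, 0 < q ∧ τ.2 = q ^ 2 :=
      ⟨√τ.2, by positivity, (Real.sq_sqrt h2.le).symm⟩
    rw [hτ2, Real.sqrt_sq hq.le] at h
    have hτ1 : τ.1 = w * q := by
      rw [← h]
      field_simp
    have hval : ∀ c : ℝ, 0 < c →
        ((q ^ 2 / 2 + c * q ^ 2 * (w ^ 2 - 1) / 2 + 1 / 2 * Real.log c : ℝ) : EReal)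
          ≤ legendre2 (Psi 2 (muP 2)) τ := by
      intro c hc
      refine le_trans (le_of_eq ?_) (le_legendre2_Psi τ (c * τ.1) c hc)
      rw [hτ1, hτ2]
      congr 1
      field_simp
      ring
    rcases lt_or_ge (w ^ 2) 1 with hw | hw
    · have hD : 0 < 1 - w ^ 2 := by linarith
      rw [J2_of_sq_lt hw]
      refine le_trans ?_ (hval (1 / (q ^ 2 * (1 - w ^ 2))) (by positivity))
      rw [EReal.coe_le_coe_iff, one_div (q ^ 2 * (1 - w ^ 2)), Real.log_inv,
        Real.log_mul (by positivity) hD.ne']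
      have h1 : (q ^ 2 * (1 - w ^ 2))⁻¹ * q ^ 2 * (w ^ 2 - 1) = -1 := by
        field_simp
        ring
      have := Real.log_le_sub_one_of_pos (pow_pos hq 2)
      rw [h1]
      linarith
    · rw [J2_of_one_le_sq hw, top_le_iff, EReal.eq_top_iff_forall_lt]
      intro M
      refine lt_of_lt_of_le ?_ (hval (Real.exp (2 * M)) (Real.exp_pos _))
      rw [EReal.coe_lt_coe_iff, Real.log_exp]
      have : 0 ≤ Real.exp (2 * M) * q ^ 2 * (w ^ 2 - 1) := by
        have := sub_nonneg.2 hw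
        positivity
      have := pow_pos hq 2
      linarith

lemma le_legendre3_Phi (τ : ℝ × ℝ × ℝ) (a b c : ℝ) (ha : 0 < a) (hd : 0 < a * c - b ^ 2) :
    (((τ.1 + τ.2.2) / 2 - (a * τ.1 + 2 * b * τ.2.1 + c * τ.2.2) / 2
        + 1 / 2 * Real.log (a * c - b ^ 2) : ℝ) : EReal) ≤ legendre3 (Phi 2) τ := by
  have hdet : (1 - 2 * ((1 - a) / 2)) * (1 - 2 * ((1 - c) / 2)) - (-b) ^ 2 = a * c - b ^ 2 := by
    ring
  refine le_trans (le_of_eq ?_) (le_iSup _ (((1 - a) / 2, -b, (1 - c) / 2) : ℝ × ℝ × ℝ))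
  rw [Phi_two_of_det_pos (t := ((1 - a) / 2, -b, (1 - c) / 2)) (by simp only; linarith)
    (by simpa only [hdet] using hd), ← EReal.coe_sub]
  simp only [hdet]
  congr 1
  ring

lemma legendre3_Phi_le (τ : ℝ × ℝ × ℝ) (M : ℝ)
    (h : ∀ a b c : ℝ, 0 < a → 0 < a * c - b ^ 2 →
      (τ.1 + τ.2.2) / 2 - (a * τ.1 + 2 * b * τ.2.1 + c * τ.2.2) / 2
        + 1 / 2 * Real.log (a * c - b ^ 2) ≤ M) :
    legendre3 (Phi 2) τ ≤ M := by
  refine iSup_le fun t => ?_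
  rcases lt_or_ge t.1 (1 / 2) with ht | ht
  · have ha : 0 < 1 - 2 * t.1 := by linarith
    rcases lt_or_ge 0 ((1 - 2 * t.1) * (1 - 2 * t.2.2) - t.2.1 ^ 2) with hd | hd
    · rw [Phi_two_of_det_pos ht hd, ← EReal.coe_sub, EReal.coe_le_coe_iff]
      have hdet : (1 - 2 * t.1) * (1 - 2 * t.2.2) - (-t.2.1) ^ 2
        = (1 - 2 * t.1) * (1 - 2 * t.2.2) - t.2.1 ^ 2 := by ring
      have h' := h (1 - 2 * t.1) (-t.2.1) (1 - 2 * t.2.2) ha (by rwa [hdet])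
      rw [hdet] at h'
      linarith
    · rw [Phi_two_of_schur_nonpos ht]
      · simp
      · rw [← sub_le_iff_le_add', le_div_iff₀ (by positivity)]
        linarith
  · rw [Phi_two_of_ge ht]
    simp

lemma Ia_two_eq (w : ℝ) : Ia 2 w = J2 w := by
  apply le_antisymm
  · rcases lt_or_ge (w ^ 2) 1 with hw | hw
    · rw [J2_of_sq_lt hw]
      refine (iInf₂_le (1, w, 1) (by simp)).trans (legendre3_Phi_le _ _ fun a b c ha hd => ?_)
      have hD : 0 < 1 - w ^ 2 := by linarith
      have hc : 0 < c := by
        by_contra! hc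
        nlinarith [mul_nonneg ha.le (neg_nonneg.2 hc), sq_nonneg b]
      set m := (a + c) / 2 with hm
      have hm0 : 0 < m := by positivity
      have hdm : a * c ≤ m ^ 2 := by
        rw [hm]
        nlinarith [sq_nonneg (a - c)]
      have hmb : 0 < m + b * w := by
        have : (b * w) ^ 2 < m ^ 2 := by
          nlinarith [mul_nonneg (sq_nonneg b) hD.le]
        linarith [(abs_lt.1 (abs_lt_of_sq_lt_sq this hm0.le)).1]
      have hle : (a * c - b ^ 2) * (1 - w ^ 2) ≤ (m + b * w) ^ 2 := by
        nlinarith [mul_le_mul_of_nonneg_right hdm hD.le, sq_nonneg (b + m * w)]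
      have hlog := Real.log_le_log (mul_pos hd hD) hle
      rw [Real.log_mul hd.ne' hD.ne', Real.log_pow] at hlog
      have hlog' := Real.log_le_sub_one_of_pos hmb
      push_cast at hlog
      simp only
      linarith
    · rw [J2_of_one_le_sq hw]
      exact le_top
  · refine le_iInf₂ fun τ hτ => ?_
    obtain ⟨h0, h2, h⟩ := hτ
    rw [rpow_neg_one_div_two h0.le, rpow_neg_one_div_two h2.le] at h
    obtain ⟨p, hp, hτ0⟩ : ∃ p : ℝ, 0 < p ∧ τ.1 = p ^ 2 :=
      ⟨√τ.1, by positivity, (Real.sq_sqrt h0.le).symm⟩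
    obtain ⟨q, hq, hτ2⟩ : ∃ q : ℝ, 0 < q ∧ τ.2.2 = q ^ 2 :=
      ⟨√τ.2.2, by positivity, (Real.sq_sqrt h2.le).symm⟩
    rw [hτ0, hτ2, Real.sqrt_sq hq.le, Real.sqrt_sq hp.le] at h
    have hτ1 : τ.2.1 = w * p * q := by
      rw [← h]
      field_simp
    rcases lt_or_ge (w ^ 2) 1 with hw | hw
    · have hD : 0 < 1 - w ^ 2 := by linarith
      rw [J2_of_sq_lt hw]
      have hdet : 1 / (p ^ 2 * (1 - w ^ 2)) * (1 / (q ^ 2 * (1 - w ^ 2)))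
          - (-w / (p * q * (1 - w ^ 2))) ^ 2 = (p ^ 2 * q ^ 2 * (1 - w ^ 2))⁻¹ := by
        field_simp
      have hlin : 1 / (p ^ 2 * (1 - w ^ 2)) * p ^ 2
          + 2 * (-w / (p * q * (1 - w ^ 2))) * (w * p * q)
          + 1 / (q ^ 2 * (1 - w ^ 2)) * q ^ 2 = 2 := by
        field_simp
        ring
      refine le_trans ?_ (le_legendre3_Phi τ (1 / (p ^ 2 * (1 - w ^ 2)))
        (-w / (p * q * (1 - w ^ 2))) (1 / (q ^ 2 * (1 - w ^ 2))) (by positivity)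
        (by rw [hdet]; positivity))
      rw [EReal.coe_le_coe_iff, hdet, hτ0, hτ1, hτ2, hlin, Real.log_inv,
        Real.log_mul (by positivity) hD.ne', Real.log_mul (by positivity) (by positivity)]
      have hlp := Real.log_le_sub_one_of_pos (pow_pos hp 2)
      have hlq := Real.log_le_sub_one_of_pos (pow_pos hq 2)
      linarith
    · rw [J2_of_one_le_sq hw, top_le_iff, EReal.eq_top_iff_forall_lt]
      intro M
      obtain ⟨σ, hσ, hσw⟩ : ∃ σ : ℝ, σ ^ 2 = 1 ∧ 1 ≤ σ * w := by
        rcases le_total 0 w with h0 | h0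
        · exact ⟨1, by norm_num, by nlinarith⟩
        · exact ⟨-1, by norm_num, by nlinarith⟩
      set s := p ^ 2 * q ^ 2 * Real.exp (2 * (M + 1)) / 2 with hs
      have hs0 : 0 < s := by positivity
      have hdet : (1 + s) / p ^ 2 * ((1 + s) / q ^ 2) - (-(s * σ) / (p * q)) ^ 2
          = (1 + 2 * s) / (p ^ 2 * q ^ 2) := by
        rw [neg_div, neg_sq, div_pow, mul_pow s, hσ]
        field_simp
        ring
      have hlin : (1 + s) / p ^ 2 * p ^ 2 + 2 * (-(s * σ) / (p * q)) * (w * p * q)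
          + (1 + s) / q ^ 2 * q ^ 2 = 2 - 2 * (s * (σ * w - 1)) := by
        field_simp
        ring
      have hlog : 2 * (M + 1) ≤ Real.log ((1 + 2 * s) / (p ^ 2 * q ^ 2)) := by
        rw [Real.le_log_iff_exp_le (by positivity), le_div_iff₀ (by positivity), hs]
        linarith
      refine lt_of_lt_of_le ?_ (le_legendre3_Phi τ ((1 + s) / p ^ 2) (-(s * σ) / (p * q))
        ((1 + s) / q ^ 2) (by positivity) (by rw [hdet]; positivity))
      rw [EReal.coe_lt_coe_iff, hdet, hτ0, hτ1, hτ2, hlin]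
      have := mul_nonneg hs0.le (sub_nonneg.2 hσw)
      have := pow_pos hp 2
      have := pow_pos hq 2
      linarith

section Ball

open scoped Pointwise

variable {n : ℕ}

lemma mem_lpBall_two {x : Fin n → ℝ} : x ∈ lpBall n 2 ↔ dotp x x ≤ 1 := by
  simp [lpBall, dotp, sq]

lemma measurableSet_lpBall_two : MeasurableSet (lpBall n 2) :=
  measurableSet_le (by fun_prop) measurable_const

lemma measurable_dotp (θ : Fin n → ℝ) : Measurable fun x => dotp x θ := by
  unfold dotp
  fun_prop

lemma dotp_comm (x y : Fin n → ℝ) : dotp x y = dotp y x := dotProduct_comm x y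

lemma dotp_self_of_mem_unitSphereSet {x : Fin n → ℝ} (hx : x ∈ unitSphereSet n) :
    dotp x x = 1 := by
  rw [← show ∑ i, x i ^ 2 = 1 from hx]
  simp only [dotp, sq]

lemma dotp_add_smul (w r : ℝ) (x y z : Fin n → ℝ) :
    dotp (w • x + r • y) z = w * dotp x z + r * dotp y z := by
  change (w • x + r • y) ⬝ᵥ z = w * (x ⬝ᵥ z) + r * (y ⬝ᵥ z)
  simp [add_dotProduct]

lemma dotp_neg_left (x y : Fin n → ℝ) : dotp (-x) y = -dotp x y := neg_dotProduct x y

lemma dotp_neg_right (x y : Fin n → ℝ) : dotp x (-y) = -dotp x y := dotProduct_neg x y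

lemma dotp_add_smul_self (w r : ℝ) {θ : Fin n → ℝ} (hθ : dotp θ θ = 1) (y : Fin n → ℝ) :
    dotp (w • θ + r • y) (w • θ + r • y)
      = w ^ 2 + 2 * w * r * dotp y θ + r ^ 2 * dotp y y := by
  rw [dotp_add_smul, dotp_comm θ, dotp_comm y, dotp_add_smul, dotp_add_smul, hθ, dotp_comm θ y]
  ring

lemma volume_real_vadd_smul (c : Fin n → ℝ) {r : ℝ} (hr : 0 ≤ r) (S : Set (Fin n → ℝ)) :
    volume.real (c +ᵥ r • S) = r ^ n * volume.real S := by
  rw [Measure.real, measure_vadd, Measure.addHaar_smul_of_nonneg _ hr, ENNReal.toReal_mul,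
    ENNReal.toReal_ofReal (by positivity), Module.finrank_fin_fun, Measure.real]

lemma volume_vadd_smul_ne_top (c : Fin n → ℝ) {r : ℝ} (hr : 0 ≤ r) {S : Set (Fin n → ℝ)}
    (hS : volume S ≠ ⊤) : volume (c +ᵥ r • S) ≠ ⊤ := by
  rw [measure_vadd, Measure.addHaar_smul_of_nonneg _ hr]
  exact ENNReal.mul_ne_top ENNReal.ofReal_ne_top hS

/-- A cap of the unit ball lies in a ball of smaller radius. -/
lemma volume_real_cap_le (hB : volume (lpBall n 2) ≠ ⊤) {θ : Fin n → ℝ} (hθ : dotp θ θ = 1)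
    {w r : ℝ} (hw : 0 ≤ w) (hr : 0 < r) (hwr : w ^ 2 + r ^ 2 = 1) :
    volume.real ({x | w ≤ dotp x θ} ∩ lpBall n 2) ≤ r ^ n * volume.real (lpBall n 2) := by
  rw [← volume_real_vadd_smul (w • θ) hr.le]
  refine measureReal_mono ?_ (volume_vadd_smul_ne_top _ hr.le hB)
  rintro x ⟨hx, hxB⟩
  have hx : w ≤ dotp x θ := hx
  have hxB := mem_lpBall_two.1 hxB
  refine mem_vadd_set.2 ⟨r • (r⁻¹ • (x - w • θ)), smul_mem_smul_set ?_, ?_⟩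
  · have heq : r⁻¹ • (x - w • θ) = (-(r⁻¹ * w)) • θ + r⁻¹ • x := by
      rw [smul_sub, neg_smul, smul_smul]
      abel
    rw [mem_lpBall_two, heq, dotp_add_smul_self _ _ hθ]
    have : (-(r⁻¹ * w)) ^ 2 + 2 * (-(r⁻¹ * w)) * r⁻¹ * dotp x θ + r⁻¹ ^ 2 * dotp x x
        = (w ^ 2 - 2 * w * dotp x θ + dotp x x) / r ^ 2 := by
      field_simp
      ring
    rw [this, div_le_one (by positivity)]
    nlinarith
  · rw [smul_inv_smul₀ hr.ne']
    simp

lemma volume_real_slab_ge (hB : volume (lpBall n 2) ≠ ⊤) {θ : Fin n → ℝ} (hθ : dotp θ θ = 1)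
    {δ ρ : ℝ} (hδ : 0 ≤ δ) (hρ : 0 < ρ) (hδρ : δ ^ 2 + ρ ^ 2 = 1) (hn : ρ ^ n ≤ 1 / 4) :
    volume.real (lpBall n 2) / 4
      ≤ volume.real ({x | dotp x θ ∈ Icc (-δ) 0} ∩ lpBall n 2) := by
  set A := {x | dotp x θ ∈ Icc (-δ) 0} ∩ lpBall n 2 with hA
  set C := {x | δ ≤ dotp x θ} ∩ lpBall n 2 with hC
  set D := {x | δ ≤ dotp x (-θ)} ∩ lpBall n 2 with hD
  have hθ' : dotp (-θ) (-θ) = 1 := by rw [dotp_neg_left, dotp_neg_right, hθ, neg_neg]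
  have hsub : lpBall n 2 ⊆ (A ∪ -A) ∪ (C ∪ D) := by
    intro x hx
    have hx' : -x ∈ lpBall n 2 := by
      rwa [mem_lpBall_two, dotp_neg_left, dotp_neg_right, neg_neg, ← mem_lpBall_two]
    simp only [hA, hC, hD, mem_union, mem_inter_iff, mem_ofPred_eq, Set.mem_neg, dotp_neg_left,
      dotp_neg_right, mem_Icc, hx, hx', and_true]
    by_contra! h
    obtain ⟨⟨h1, h2⟩, h3, h4⟩ := h
    rcases le_total (dotp x θ) 0 with h0 | h0
    · linarith [h1 (by linarith)]
    · linarith [h2 (by linarith)]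
  have hfin : ∀ T : Set (Fin n → ℝ), volume (T ∩ lpBall n 2) ≠ ⊤ := fun T =>
    measure_ne_top_of_subset inter_subset_right hB
  have hAneg : volume.real (-A) = volume.real A := by
    rw [Measure.real, Measure.measure_neg, Measure.real]
  have hAneg_fin : volume (-A) ≠ ⊤ := by
    rw [Measure.measure_neg]
    exact hfin _
  have h1 := measureReal_mono hsub (measure_union_ne_top
    (measure_union_ne_top (hfin _) hAneg_fin) (measure_union_ne_top (hfin _) (hfin _)))
  have h2 := measureReal_union_le (μ := volume) (A ∪ -A) (C ∪ D)
  have h3 := measureReal_union_le (μ := volume) A (-A)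
  have h4 := measureReal_union_le (μ := volume) C D
  have h5 := volume_real_cap_le hB hθ hδ hρ hδρ
  have h6 := volume_real_cap_le hB hθ' hδ hρ hδρ
  have h7 : ρ ^ n * volume.real (lpBall n 2) ≤ 1 / 4 * volume.real (lpBall n 2) :=
    mul_le_mul_of_nonneg_right hn measureReal_nonneg
  linarith

/-- A slab of the unit ball around height `w` contains a scaled copy of a central half-slab. -/
lemma volume_real_slab_at_ge (hB : volume (lpBall n 2) ≠ ⊤) {θ : Fin n → ℝ} (hθ : dotp θ θ = 1)
    {w r δ ρ : ℝ} (hw : 0 ≤ w) (hr : 0 < r) (hwr : w ^ 2 + r ^ 2 = 1)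
    (hδ : 0 ≤ δ) (hρ : 0 < ρ) (hδρ : δ ^ 2 + ρ ^ 2 = 1) (hn : ρ ^ n ≤ 1 / 4) :
    r ^ n / 4 * volume.real (lpBall n 2)
      ≤ volume.real ({x | |dotp x θ - w| ≤ δ} ∩ lpBall n 2) := by
  have h := mul_le_mul_of_nonneg_left (volume_real_slab_ge hB hθ hδ hρ hδρ hn) (pow_pos hr n).le
  rw [← volume_real_vadd_smul (w • θ) hr.le] at h
  refine le_trans (le_of_eq (by ring)) (h.trans (measureReal_mono ?_
    (measure_ne_top_of_subset inter_subset_right hB)))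
  intro x hx
  obtain ⟨_, ⟨y, ⟨hy, hyB⟩, rfl⟩, rfl⟩ := hx
  obtain ⟨hy1, hy2⟩ : -δ ≤ dotp y θ ∧ dotp y θ ≤ 0 := hy
  have hyB := mem_lpBall_two.1 hyB
  have hr1 : r ≤ 1 := by nlinarith
  change |dotp (w • θ + r • y) θ - w| ≤ δ ∧ w • θ + r • y ∈ lpBall n 2
  rw [mem_lpBall_two, dotp_add_smul_self _ _ hθ, dotp_add_smul, hθ, abs_le]
  have := mul_nonneg (mul_nonneg hw hr.le) (neg_nonneg.2 hy2)
  have := mul_le_mul_of_nonneg_left hyB (sq_nonneg r)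
  refine ⟨⟨?_, ?_⟩, ?_⟩ <;> nlinarith

lemma uniformLpBall_real_apply {S : Set (Fin n → ℝ)} (hS : MeasurableSet S) :
    (uniformLpBall n 2).real S = (volume.real (lpBall n 2))⁻¹ * volume.real (S ∩ lpBall n 2) := by
  rw [uniformLpBall, measureReal_ennreal_smul_apply, measureReal_restrict_apply hS,
    ENNReal.toReal_inv]
  rfl

lemma volume_lpBall_two_of_isProbabilityMeasure (h : IsProbabilityMeasure (uniformLpBall n 2)) :
    volume (lpBall n 2) ≠ 0 ∧ volume (lpBall n 2) ≠ ⊤ := by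
  have h1 : (volume (lpBall n 2))⁻¹ * volume (lpBall n 2) = 1 := by
    simpa [uniformLpBall] using h.measure_univ
  constructor <;> intro h0 <;> simp [h0] at h1

lemma uniformLpBall_real_abs_gt_le (h : IsProbabilityMeasure (uniformLpBall n 2))
    {θ : Fin n → ℝ} (hθ : dotp θ θ = 1) {w r : ℝ} (hw : 0 ≤ w) (hr : 0 < r)
    (hwr : w ^ 2 + r ^ 2 = 1) :
    (uniformLpBall n 2).real {x | w < |dotp x θ|} ≤ 2 * r ^ n := by
  obtain ⟨hB0, hB⟩ := volume_lpBall_two_of_isProbabilityMeasure h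
  have hV : 0 < volume.real (lpBall n 2) := ENNReal.toReal_pos hB0 hB
  have hcap : ∀ θ : Fin n → ℝ, dotp θ θ = 1 →
      (uniformLpBall n 2).real {x | w ≤ dotp x θ} ≤ r ^ n := by
    intro θ hθ
    rw [uniformLpBall_real_apply (measurableSet_le measurable_const (measurable_dotp θ)),
      inv_mul_le_iff₀ hV, mul_comm]
    exact volume_real_cap_le hB hθ hw hr hwr
  have hθ' : dotp (-θ) (-θ) = 1 := by rw [dotp_neg_left, dotp_neg_right, hθ, neg_neg]
  have hsub : {x | w < |dotp x θ|} ⊆ {x | w ≤ dotp x θ} ∪ {x | w ≤ dotp x (-θ)} := by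
    intro x hx
    have hx : w < |dotp x θ| := hx
    rcases lt_abs.1 hx with h | h
    · exact Or.inl h.le
    · exact Or.inr (by simpa [dotp_neg_right] using h.le)
  linarith [measureReal_mono (μ := uniformLpBall n 2) hsub, hcap θ hθ, hcap _ hθ',
    measureReal_union_le (μ := uniformLpBall n 2) {x | w ≤ dotp x θ} {x | w ≤ dotp x (-θ)}]

lemma uniformLpBall_real_abs_sub_le_ge (h : IsProbabilityMeasure (uniformLpBall n 2))
    {θ : Fin n → ℝ} (hθ : dotp θ θ = 1) {w r δ ρ : ℝ} (hr : 0 < r)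
    (hwr : w ^ 2 + r ^ 2 = 1) (hδ : 0 ≤ δ) (hρ : 0 < ρ) (hδρ : δ ^ 2 + ρ ^ 2 = 1)
    (hn : ρ ^ n ≤ 1 / 4) :
    r ^ n / 4 ≤ (uniformLpBall n 2).real {x | |dotp x θ - w| ≤ δ} := by
  obtain ⟨hB0, hB⟩ := volume_lpBall_two_of_isProbabilityMeasure h
  have hV : 0 < volume.real (lpBall n 2) := ENNReal.toReal_pos hB0 hB
  have hms : MeasurableSet {x : Fin n → ℝ | |dotp x θ - w| ≤ δ} :=
    measurableSet_le ((measurable_dotp θ).sub_const w).abs measurable_const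
  rw [uniformLpBall_real_apply hms, le_inv_mul_iff₀ hV, mul_comm]
  rcases le_total 0 w with hw | hw
  · exact volume_real_slab_at_ge hB hθ hw hr hwr hδ hρ hδρ hn
  · have hθ' : dotp (-θ) (-θ) = 1 := by rw [dotp_neg_left, dotp_neg_right, hθ, neg_neg]
    have h' := volume_real_slab_at_ge hB hθ' (neg_nonneg.2 hw) hr (by rwa [neg_sq]) hδ hρ hδρ hn
    have habs : ∀ x : Fin n → ℝ, |dotp x (-θ) - -w| = |dotp x θ - w| := by
      intro x
      rw [dotp_neg_right, ← abs_neg]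
      congr 1
      ring
    simpa only [habs] using h'

end Ball

lemma tendsto_inv_mul_log_exp (c : ℝ) {K : ℝ} (hK : 0 < K) :
    Tendsto (fun n : ℕ => (((n : ℝ)⁻¹ : ℝ) : EReal)
      * ENNReal.log (ENNReal.ofReal (K * Real.exp (-c) ^ n))) atTop (𝓝 ((-c : ℝ) : EReal)) := by
  have hlim : Tendsto (fun n : ℕ => (n : ℝ)⁻¹ * Real.log K - c) atTop (𝓝 (-c)) := by
    have := (tendsto_inv_atTop_nhds_zero_nat (𝕜 := ℝ)).mul_const (Real.log K)
    simpa using this.sub_const c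
  refine (EReal.tendsto_coe.2 hlim).congr' ?_
  filter_upwards [eventually_gt_atTop 0] with n hn
  have hn' : (n : ℝ) ≠ 0 := by positivity
  rw [ENNReal.log_ofReal_of_pos (by positivity), ← EReal.coe_mul,
    Real.log_mul hK.ne' (by positivity), Real.log_pow, Real.log_exp]
  congr 1
  field_simp
  ring

section Asymptotics

variable {Ω : Type*} [MeasurableSpace Ω] {P : Measure Ω} [IsProbabilityMeasure P]

lemma inv_mul_log_mono (n : ℕ) {a b : ℝ≥0∞} (h : a ≤ b) :
    (((n : ℝ)⁻¹ : ℝ) : EReal) * ENNReal.log a ≤ (((n : ℝ)⁻¹ : ℝ) : EReal) * ENNReal.log b :=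
  mul_le_mul_of_nonneg_left (ENNReal.log_le_log h) (EReal.coe_nonneg.2 (by positivity))

lemma limsup_log_le {S : ℕ → Set Ω} {c K : ℝ} (hK : 0 < K)
    (h : ∀ᶠ n in atTop, P.real (S n) ≤ K * Real.exp (-c) ^ n) :
    (atTop.limsup fun n : ℕ => (((n : ℝ)⁻¹ : ℝ) : EReal) * ENNReal.log (P (S n)))
      ≤ ((-c : ℝ) : EReal) := by
  rw [← (tendsto_inv_mul_log_exp c hK).limsup_eq]
  refine limsup_le_limsup ?_
  filter_upwards [h] with n hn
  refine inv_mul_log_mono n ?_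
  rw [← ofReal_measureReal]
  exact ENNReal.ofReal_le_ofReal hn

lemma le_liminf_log {S : ℕ → Set Ω} {c K : ℝ} (hK : 0 < K)
    (h : ∀ᶠ n in atTop, K * Real.exp (-c) ^ n ≤ P.real (S n)) :
    ((-c : ℝ) : EReal)
      ≤ atTop.liminf fun n : ℕ => (((n : ℝ)⁻¹ : ℝ) : EReal) * ENNReal.log (P (S n)) := by
  rw [← (tendsto_inv_mul_log_exp c hK).liminf_eq]
  refine liminf_le_liminf ?_
  filter_upwards [h] with n hn
  refine inv_mul_log_mono n ?_
  rw [← ofReal_measureReal (μ := P)]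
  exact ENNReal.ofReal_le_ofReal hn

variable {X : (n : ℕ) → Ω → (Fin n → ℝ)} {θ : (n : ℕ) → Fin n → ℝ}

lemma ldp_upper_bound (hXmeas : ∀ n, Measurable (X n))
    (hX : ∀ n, 0 < n → Measure.map (X n) P = uniformLpBall n 2)
    (hθ : ∀ n, 0 < n → θ n ∈ unitSphereSet n) (F : Set ℝ) :
    (atTop.limsup fun n : ℕ =>
        (((n : ℝ)⁻¹ : ℝ) : EReal) * ENNReal.log (P {ω | dotp (X n ω) (θ n) ∈ F}))
      ≤ -(⨅ x ∈ F, J2 x) := by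
  rw [← EReal.le_of_forall_lt_iff_le]
  intro z hz
  obtain ⟨c, rfl⟩ : ∃ c : ℝ, z = -c := ⟨-z, (neg_neg z).symm⟩
  refine limsup_log_le two_pos ?_
  rcases lt_or_ge c 0 with hc | hc
  · refine Eventually.of_forall fun n => ?_
    have := one_le_pow₀ (n := n) (Real.one_le_exp (neg_nonneg.2 hc.le))
    linarith [measureReal_le_one (μ := P) (s := {ω | dotp (X n ω) (θ n) ∈ F})]
  filter_upwards [eventually_gt_atTop 0] with n hn
  have hprob : IsProbabilityMeasure (uniformLpBall n 2) :=
    hX n hn ▸ Measure.isProbabilityMeasure_map (hXmeas n).aemeasurable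
  have hexp : Real.exp (-c) ^ 2 = Real.exp (-2 * c) := by
    rw [← Real.exp_nat_mul]
    congr 1
    push_cast
    ring
  have hle1 : Real.exp (-2 * c) ≤ 1 := Real.exp_le_one_iff.2 (by linarith)
  have hw : √(1 - Real.exp (-2 * c)) ^ 2 = 1 - Real.exp (-2 * c) := Real.sq_sqrt (by linarith)
  have hms : MeasurableSet {x | √(1 - Real.exp (-2 * c)) < |dotp x (θ n)|} :=
    measurableSet_lt measurable_const (measurable_dotp (θ n)).abs
  refine le_trans ?_ (uniformLpBall_real_abs_gt_le hprob
    (θ := θ n) (dotp_self_of_mem_unitSphereSet (hθ n hn))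
    (Real.sqrt_nonneg (1 - Real.exp (-2 * c))) (Real.exp_pos (-c)) (by rw [hw, hexp]; ring))
  rw [← hX n hn, map_measureReal_apply (hXmeas n) hms]
  refine measureReal_mono fun ω hω => ?_
  change _ < |dotp (X n ω) (θ n)|
  have hJ : ((c : ℝ) : EReal) < J2 (dotp (X n ω) (θ n)) := by
    refine lt_of_lt_of_le ?_ (iInf₂_le (f := fun x (_ : x ∈ F) => J2 x) _ hω)
    rw [EReal.coe_neg] at hz
    exact EReal.neg_lt_neg_iff.1 hz
  rw [← not_le, J2_le_coe_iff, not_le, ← sq_abs] at hJ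
  exact lt_of_pow_lt_pow_left₀ 2 (abs_nonneg _) (by rwa [hw])

lemma ldp_lower_bound (hXmeas : ∀ n, Measurable (X n))
    (hX : ∀ n, 0 < n → Measure.map (X n) P = uniformLpBall n 2)
    (hθ : ∀ n, 0 < n → θ n ∈ unitSphereSet n) {U : Set ℝ} (hU : IsOpen U) :
    -(⨅ x ∈ U, J2 x) ≤ atTop.liminf fun n : ℕ =>
        (((n : ℝ)⁻¹ : ℝ) : EReal) * ENNReal.log (P {ω | dotp (X n ω) (θ n) ∈ U}) := by
  rw [EReal.neg_le]
  refine le_iInf₂ fun w hwU => ?_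
  rw [EReal.neg_le]
  rcases le_or_gt 1 (w ^ 2) with hw | hw
  · simp [J2_of_one_le_sq hw]
  rw [J2_of_sq_lt hw, ← EReal.coe_neg]
  refine le_liminf_log (K := 1 / 4) (by norm_num) ?_
  have hD : 0 < 1 - w ^ 2 := by linarith
  have hr : Real.exp (-(-(1 / 2) * Real.log (1 - w ^ 2))) ^ 2 = 1 - w ^ 2 := by
    rw [← Real.exp_nat_mul]
    push_cast
    rw [show (2 : ℝ) * -(-(1 / 2) * Real.log (1 - w ^ 2)) = Real.log (1 - w ^ 2) by ring,
      Real.exp_log hD]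
  obtain ⟨ε, hε, hεU⟩ := Metric.isOpen_iff.1 hU w hwU
  set δ := min (ε / 2) (1 / 2) with hδ
  have hδ0 : 0 < δ := by positivity
  have hδε : δ < ε := (min_le_left _ _).trans_lt (half_lt_self hε)
  have hδ1 : δ ≤ 1 / 2 := min_le_right _ _
  have hρ2 : √(1 - δ ^ 2) ^ 2 = 1 - δ ^ 2 := Real.sq_sqrt (by nlinarith)
  have hρ0 : 0 < √(1 - δ ^ 2) := Real.sqrt_pos.2 (by nlinarith)
  have hρ1 : √(1 - δ ^ 2) < 1 := by nlinarith
  have hpow := (tendsto_pow_atTop_nhds_zero_of_lt_one hρ0.le hρ1).eventually_le_const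
    (show (0 : ℝ) < 1 / 4 by norm_num)
  filter_upwards [eventually_gt_atTop 0, hpow] with n hn hρn
  have hprob : IsProbabilityMeasure (uniformLpBall n 2) :=
    hX n hn ▸ Measure.isProbabilityMeasure_map (hXmeas n).aemeasurable
  have hms : MeasurableSet {x | |dotp x (θ n) - w| ≤ δ} :=
    measurableSet_le ((measurable_dotp (θ n)).sub_const w).abs measurable_const
  have h := uniformLpBall_real_abs_sub_le_ge hprob (θ := θ n) (w := w)
    (dotp_self_of_mem_unitSphereSet (hθ n hn))
    (Real.exp_pos _) (by rw [hr]; ring) hδ0.le hρ0 (by rw [hρ2]; ring) hρn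
  rw [← hX n hn, map_measureReal_apply (hXmeas n) hms] at h
  refine le_trans (le_of_eq (by ring)) (h.trans (measureReal_mono fun ω hω => hεU ?_))
  rw [Metric.mem_ball, Real.dist_eq]
  exact lt_of_le_of_lt hω hδε

end Asymptotics

/-- For `p = 2`, the quenched LDP holds for every sequence of directions,
with rate `J₂`, and `𝕀ᵃ₂ = 𝕀^q_{2,μ₂} = J₂`. -/
theorem statement6
    {Ω : Type*} [MeasurableSpace Ω] (P : Measure Ω) [IsProbabilityMeasure P]
    (X : (n : ℕ) → Ω → (Fin n → ℝ))
    (hXmeas : ∀ n, Measurable (X n))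
    (hX : ∀ n, 0 < n → Measure.map (X n) P = uniformLpBall n 2) :
    (∀ θ : (n : ℕ) → Fin n → ℝ, (∀ n, 0 < n → θ n ∈ unitSphereSet n) →
      IsLDP P (fun n ω => dotp (X n ω) (θ n)) (fun n => (n : ℝ)) J2
      ∧ HasCompactSublevels J2)
    ∧ (∀ w : ℝ, Ia 2 w = J2 w)
    ∧ (∀ w : ℝ, Iq 2 (muP 2) w = J2 w) := by
  exact ⟨fun θ hθ => ⟨⟨lowerSemicontinuous_J2, fun Γ _ =>
    ⟨ldp_lower_bound hXmeas hX hθ isOpen_interior, ldp_upper_bound hXmeas hX hθ (closure Γ)⟩⟩,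
    hasCompactSublevels_J2⟩, Ia_two_eq, Iq_two_eq⟩
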